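/- There exists an absolute positive constant γ such that the following holds. Let U be an n×n real matrix with UᵀU = n·I and coherence μ = max_{k,j}|U_{k,j}|, fix T ⊆ {1,…,n}, let δ₁,…,δ_n be i.i.d. Bernoulli(m/n) random variables defining Ω = {k : δ_k = 1}, and let z ∈ {−1,+1}^T be i.i.d. symmetric signs independent of Ω. For t₀ ∉ T set v^{t₀} = Σ_k δ_k U_{k,t₀} u^k with u^k = (U_{k,t})_{t∈T}, and when U_{ΩT}ᵀU_{ΩT} is invertible set π(t₀) = ⟨(U_{ΩT}ᵀU_{ΩT})^{−1} v^{t₀}, z⟩. Let σ̄² = μ² m · max(1, μ|T|/√m), fix a > 0 obeying a ≤ (m/μ²)^{1/4} if μ|T|/√m > 1 and a ≤ (m/(μ²|T|))^{1/2} otherwise, and set λ = 2μ√(|T|/m) + 2aσ̄/m. Then P( λ_min(U_{ΩT}ᵀU_{ΩT}) < m/2, or sup_{t₀∉T} |π(t₀)| > 1 ) ≤ 2n·e^{−1/(2λ²)} + n·e^{−γa²} + P( λ_min(U_{ΩT}ᵀU_{ΩT}) < m/2 ). -/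

import Mathlib

open Classical Finset Matrix Real

/-- Spectral (operator ℓ²) norm of a real matrix. -/
noncomputable def specNorm {ι κ : Type*} [Fintype ι] [Fintype κ] [DecidableEq κ]
    (A : Matrix ι κ ℝ) : ℝ :=
  ‖LinearMap.toContinuousLinearMap (Matrix.toEuclideanLin A)‖

/-- Coherence: the largest magnitude among the entries of `U`. -/
noncomputable def coh {n : ℕ} (U : Matrix (Fin n) (Fin n) ℝ) : ℝ :=
  ⨆ k, ⨆ j, |U k j|

/-- Uniform probability of the event `E` on the finite sample space `s`. -/
noncomputable def uprob {α : Type*} (s : Finset α) (E : α → Prop) : ℝ :=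
  ((s.filter E).card : ℝ) / s.card

/-- Weight of the outcome `ω` for i.i.d. Bernoulli(m/n) variables `δ_k = ω k`. -/
noncomputable def bweight (n m : ℕ) (ω : Fin n → Bool) : ℝ :=
  ∏ k, if ω k then (m : ℝ) / n else 1 - (m : ℝ) / n

/-- Expectation under the i.i.d. Bernoulli(m/n) model. -/
noncomputable def bexp (n m : ℕ) (f : (Fin n → Bool) → ℝ) : ℝ :=
  ∑ ω : Fin n → Bool, bweight n m ω * f ω

/-- Probability of an event under the i.i.d. Bernoulli(m/n) model. -/
noncomputable def bprob (n m : ℕ) (E : (Fin n → Bool) → Prop) : ℝ :=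
  ∑ ω : Fin n → Bool, if E ω then bweight n m ω else 0

/-- Euclidean norm of a finitely indexed real vector. -/
noncomputable def l2norm {ι : Type*} [Fintype ι] (v : ι → ℝ) : ℝ :=
  Real.sqrt (∑ i, v i ^ 2)

/-- Probability of an event for the pair `(δ, z)` where `δ₁,…,δ_n` are i.i.d.
Bernoulli(m/n) variables and `z : T → {±1}` is an independent uniformly random
sign sequence. -/
noncomputable def jprob (n m : ℕ) {T : Finset (Fin n)}
    (E : (Fin n → Bool) × (↥T → Bool) → Prop) : ℝ :=
  ∑ p : (Fin n → Bool) × (↥T → Bool),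
    if E p then bweight n m p.1 * ((1 : ℝ) / 2) ^ T.card else 0

section GaussianIntegrals

variable {E : Type*} [NormedAddCommGroup E] [InnerProductSpace ℝ E] [FiniteDimensional ℝ E]
  [MeasurableSpace E] [BorelSpace E]

lemma integrable_exp_neg_mul_sq_norm_add_inner {b : ℝ} (hb : 0 < b) (w : E) :
    MeasureTheory.Integrable (fun x : E => Real.exp (-b * ‖x‖ ^ 2 + inner ℝ w x)) := by
  have h := (GaussianFourier.integrable_cexp_neg_mul_sq_norm_add (V := E) (b := (b : ℂ))
    (by simpa using hb) 1 w).re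
  refine h.congr (Filter.Eventually.of_forall fun x => ?_)
  have : (-(b : ℂ) * (‖x‖ : ℂ) ^ 2 + 1 * ((inner ℝ w x : ℝ) : ℂ)) =
      ((-b * ‖x‖ ^ 2 + inner ℝ w x : ℝ) : ℂ) := by push_cast; ring
  simp only [this]
  exact Complex.exp_ofReal_re _

lemma integral_exp_neg_mul_sq_norm_add_inner {b : ℝ} (hb : 0 < b) (w : E) :
    ∫ x : E, Real.exp (-b * ‖x‖ ^ 2 + inner ℝ w x) =
      Real.exp (‖w‖ ^ 2 / (4 * b)) * ∫ x : E, Real.exp (-b * ‖x‖ ^ 2) := by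
  rw [← MeasureTheory.integral_add_right_eq_self _ ((2 * b)⁻¹ • w),
    ← MeasureTheory.integral_const_mul]
  refine MeasureTheory.integral_congr_ae (Filter.Eventually.of_forall fun x => ?_)
  simp only
  rw [← Real.exp_add]
  congr 1
  rw [norm_add_sq_real, inner_add_right, inner_smul_right, inner_smul_right, norm_smul,
    real_inner_self_eq_norm_sq, real_inner_comm w x, mul_pow, Real.norm_eq_abs, sq_abs]
  field_simp
  ring

lemma integrable_inner_mul_exp_neg_mul_sq_norm {b : ℝ} (hb : 0 < b) (w : E) :
    MeasureTheory.Integrable (fun x : E => inner ℝ w x * Real.exp (-b * ‖x‖ ^ 2)) := by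
  refine ((integrable_exp_neg_mul_sq_norm_add_inner hb w).add
    (integrable_exp_neg_mul_sq_norm_add_inner hb (-w))).mono' (by fun_prop)
    (Filter.Eventually.of_forall fun x => ?_)
  simp only [Pi.add_apply, Real.exp_add, inner_neg_left, norm_mul, Real.norm_eq_abs, Real.abs_exp]
  rw [← mul_add, mul_comm]
  gcongr
  have h1 := Real.add_one_le_exp (inner ℝ w x)
  have h2 := Real.add_one_le_exp (-inner ℝ w x)
  have h3 := Real.exp_pos (inner ℝ w x)
  have h4 := Real.exp_pos (-inner ℝ w x)
  exact abs_le.2 ⟨by linarith, by linarith⟩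

lemma integral_inner_mul_exp_neg_mul_sq_norm (b : ℝ) (w : E) :
    ∫ x : E, inner ℝ w x * Real.exp (-b * ‖x‖ ^ 2) = 0 := by
  have h := MeasureTheory.integral_neg_eq_self
    (fun x : E => inner ℝ w x * Real.exp (-b * ‖x‖ ^ 2)) MeasureTheory.volume
  simp only [inner_neg_right, norm_neg, neg_mul, MeasureTheory.integral_neg] at h
  simp only [neg_mul]
  linarith

/-- Gaussian change of measure: Jensen's inequality after translating by `h`. -/
lemma exp_mul_integral_le_integral_exp_sub {b R : ℝ} (hb : 0 < b) (v h : E) {L : E → ℝ}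
    (hLc : Continuous L) (hL0 : ∀ x, 0 ≤ L x)
    (hLi : MeasureTheory.Integrable fun x => L (x + h) * Real.exp (-b * ‖x‖ ^ 2))
    (hR : ∫ x, L (x + h) * Real.exp (-b * ‖x‖ ^ 2) ≤ R * ∫ x : E, Real.exp (-b * ‖x‖ ^ 2)) :
    Real.exp (inner ℝ h v - b * ‖h‖ ^ 2 - R) * ∫ x : E, Real.exp (-b * ‖x‖ ^ 2) ≤
      ∫ x, Real.exp (inner ℝ x v - L x) * Real.exp (-b * ‖x‖ ^ 2) := by
  have hg : MeasureTheory.Integrable fun x : E => Real.exp (-b * ‖x‖ ^ 2) := by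
    simpa using integrable_exp_neg_mul_sq_norm_add_inner hb (0 : E)
  have hint : MeasureTheory.Integrable
      fun x => Real.exp (inner ℝ x v - L x) * Real.exp (-b * ‖x‖ ^ 2) := by
    refine (integrable_exp_neg_mul_sq_norm_add_inner hb v).mono' (by fun_prop)
      (Filter.Eventually.of_forall fun x => ?_)
    rw [norm_mul, Real.norm_eq_abs, Real.norm_eq_abs, Real.abs_exp, Real.abs_exp, ← Real.exp_add,
      real_inner_comm]
    exact Real.exp_le_exp.2 (by linarith [hL0 x])
  set c := inner ℝ h v - b * ‖h‖ ^ 2 - R with hc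
  set y := v - (2 * b) • h with hy
  have hsum : MeasureTheory.Integrable fun x : E =>
      (1 + R) * Real.exp (-b * ‖x‖ ^ 2) + inner ℝ y x * Real.exp (-b * ‖x‖ ^ 2) :=
    (hg.const_mul _).add (integrable_inner_mul_exp_neg_mul_sq_norm hb y)
  have hlow : MeasureTheory.Integrable fun x => Real.exp c *
      ((1 + R) * Real.exp (-b * ‖x‖ ^ 2) + inner ℝ y x * Real.exp (-b * ‖x‖ ^ 2) -
        L (x + h) * Real.exp (-b * ‖x‖ ^ 2)) :=
    (hsum.sub hLi).const_mul _
  calc Real.exp c * ∫ x : E, Real.exp (-b * ‖x‖ ^ 2)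
      ≤ ∫ x, Real.exp c *
      ((1 + R) * Real.exp (-b * ‖x‖ ^ 2) + inner ℝ y x * Real.exp (-b * ‖x‖ ^ 2) -
        L (x + h) * Real.exp (-b * ‖x‖ ^ 2)) := by
        rw [MeasureTheory.integral_const_mul, MeasureTheory.integral_sub hsum hLi,
          MeasureTheory.integral_add (hg.const_mul _)
          (integrable_inner_mul_exp_neg_mul_sq_norm hb y),
          integral_inner_mul_exp_neg_mul_sq_norm, MeasureTheory.integral_const_mul]
        gcongr
        linarith
    _ ≤ ∫ x, Real.exp (inner ℝ (x + h) v - L (x + h)) * Real.exp (-b * ‖x + h‖ ^ 2) := by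
        refine MeasureTheory.integral_mono hlow (hint.comp_add_right h) fun x => ?_
        simp only
        have key : Real.exp (inner ℝ (x + h) v - L (x + h)) * Real.exp (-b * ‖x + h‖ ^ 2) =
            Real.exp c * (Real.exp (inner ℝ y x - L (x + h) + R) * Real.exp (-b * ‖x‖ ^ 2)) := by
          rw [← Real.exp_add, ← Real.exp_add, ← Real.exp_add, norm_add_sq_real, inner_add_left,
            hy, inner_sub_left, inner_smul_left, hc, real_inner_comm x v, real_inner_comm x h]
          congr 1
          simp
          ring
        rw [key]
        gcongr
        have := Real.add_one_le_exp (inner ℝ y x - L (x + h) + R)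
        nlinarith [Real.exp_pos (-b * ‖x‖ ^ 2)]
    _ = _ := MeasureTheory.integral_add_right_eq_self
        (fun x => Real.exp (inner ℝ x v - L x) * Real.exp (-b * ‖x‖ ^ 2)) h

lemma sum_bernoulli_mul_exp_le {κ : Type*} [Fintype κ] [DecidableEq κ] {p : ℝ}
    (hp0 : 0 ≤ p) (hp1 : p ≤ 1) (y : κ → ℝ) :
    ∑ ω : κ → Bool, (∏ k, if ω k then p else 1 - p) *
        Real.exp (∑ k, if ω k then y k else 0) ≤
      Real.exp (p * ∑ k, (Real.exp (y k) - 1)) := by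
  have h : ∀ ω : κ → Bool, (∏ k, if ω k then p else 1 - p) *
      Real.exp (∑ k, if ω k then y k else 0) =
      ∏ k, (if ω k then p * Real.exp (y k) else 1 - p) := fun ω => by
    rw [Real.exp_sum, ← Finset.prod_mul_distrib]
    refine Finset.prod_congr rfl fun k _ => ?_
    split_ifs <;> simp
  simp_rw [h]
  rw [← Fintype.prod_sum (fun k (c : Bool) => if c then p * Real.exp (y k) else 1 - p),
    Finset.mul_sum, Real.exp_sum]
  refine Finset.prod_le_prod (fun k _ => ?_) fun k _ => ?_
  · simp only [Fintype.sum_bool, if_true, Bool.false_eq_true, if_false]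
    have := Real.exp_pos (y k)
    nlinarith [mul_nonneg hp0 this.le]
  · simp only [Fintype.sum_bool, if_true, Bool.false_eq_true, if_false]
    linarith [Real.add_one_le_exp (p * (Real.exp (y k) - 1))]

lemma exp_sub_one_le_of_abs_le {m s : ℝ} (hm : |m| ≤ 1 / 2) (hs0 : 0 ≤ s) (hs : s ≤ 1) :
    Real.exp (m + s / 2) - 1 ≤ m + s / 2 + (2 * m ^ 2 + s ^ 2 / 2) := by
  have hm' := abs_le.1 hm
  have h := Real.abs_exp_sub_one_sub_id_le (x := m + s / 2)
    (abs_le.2 ⟨by linarith, by linarith⟩)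
  nlinarith [le_abs_self (Real.exp (m + s / 2) - 1 - (m + s / 2)), sq_nonneg (m - s / 2)]

/-- Exponential moment of the norm of a Bernoulli sum of vectors adding up to zero, with the
root mean square `M` of the norm entering the exponent with constant one. -/
theorem sum_bernoulli_mul_exp_norm_le {κ : Type*} [Fintype κ] [DecidableEq κ]
    {p τ M S B : ℝ} (hp0 : 0 ≤ p) (hp1 : p ≤ 1) (w : κ → E) (hw0 : ∑ k, w k = 0)
    (hS : ∀ f : E, p * ∑ k, inner ℝ f (w k) ^ 2 ≤ S * ‖f‖ ^ 2)
    (hS0 : 0 ≤ S) (hM : p * ∑ k, ‖w k‖ ^ 2 ≤ M ^ 2) (hM0 : 0 < M) (hB : ∀ k, ‖w k‖ ≤ B)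
    (hτ : 0 < τ) (hτB : τ * B ≤ 1 / 2) (hτM : τ * B ^ 2 ≤ M) :
    ∑ ω : κ → Bool, (∏ k, if ω k then p else 1 - p) *
        Real.exp (τ * ‖∑ k, (if ω k then (1 : ℝ) else 0) • w k‖) ≤
      Real.exp (τ * M + τ ^ 2 * (2 * S + B ^ 2 / 2)) := by
  set b := M / (2 * τ) with hbdef
  have hb : 0 < b := by positivity
  set N := ∫ x : E, Real.exp (-b * ‖x‖ ^ 2) with hN
  have hg : MeasureTheory.Integrable fun x : E => Real.exp (-b * ‖x‖ ^ 2) := by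
    simpa using integrable_exp_neg_mul_sq_norm_add_inner hb (0 : E)
  have hNpos : 0 < N := MeasureTheory.integral_exp_pos hg
  set L : E → ℝ := fun x => p * ∑ k, (Real.exp (inner ℝ x (w k)) - 1) with hL
  have hLc : Continuous L := by fun_prop
  have hL0 : ∀ x, 0 ≤ L x := fun x => by
    refine mul_nonneg hp0 ?_
    have h0 : ∑ k, inner ℝ x (w k) = 0 := by rw [← inner_sum, hw0, inner_zero_right]
    rw [← h0]
    exact Finset.sum_le_sum fun k _ => by linarith [Real.add_one_le_exp (inner ℝ x (w k))]
  have hterm : ∀ (h : E) (x : E), L (x + h) * Real.exp (-b * ‖x‖ ^ 2) =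
      ∑ k, (p * (Real.exp (inner ℝ h (w k)) * Real.exp (-b * ‖x‖ ^ 2 + inner ℝ (w k) x)) -
        p * Real.exp (-b * ‖x‖ ^ 2)) := fun h x => by
    simp only [hL, Finset.mul_sum, Finset.sum_mul]
    refine Finset.sum_congr rfl fun k _ => ?_
    rw [inner_add_left, Real.exp_add, Real.exp_add, real_inner_comm]
    ring
  have htermi : ∀ (h : E), ∀ k ∈ Finset.univ, MeasureTheory.Integrable fun x : E =>
      (p * (Real.exp (inner ℝ h (w k)) * Real.exp (-b * ‖x‖ ^ 2 + inner ℝ (w k) x)) -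
        p * Real.exp (-b * ‖x‖ ^ 2)) := fun h k _ =>
    (((integrable_exp_neg_mul_sq_norm_add_inner hb (w k)).const_mul _).const_mul _).sub
      (hg.const_mul _)
  set R := τ * M / 2 + τ ^ 2 * (2 * S + B ^ 2 / 2) with hRdef
  have hR : ∀ h : E, ‖h‖ ≤ τ →
      ∫ x, L (x + h) * Real.exp (-b * ‖x‖ ^ 2) ≤ R * N := fun h hh => by
    simp_rw [hterm h]
    rw [MeasureTheory.integral_finsetSum _ (htermi h)]
    have h1 : ∀ k, ∫ x : E,
        (p * (Real.exp (inner ℝ h (w k)) * Real.exp (-b * ‖x‖ ^ 2 + inner ℝ (w k) x)) -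
        p * Real.exp (-b * ‖x‖ ^ 2)) =
        p * (Real.exp (inner ℝ h (w k) + (τ * ‖w k‖ ^ 2 / M) / 2) - 1) * N := fun k => by
      rw [MeasureTheory.integral_sub
        (((integrable_exp_neg_mul_sq_norm_add_inner hb (w k)).const_mul _).const_mul _)
        (hg.const_mul _), MeasureTheory.integral_const_mul, MeasureTheory.integral_const_mul,
        MeasureTheory.integral_const_mul, integral_exp_neg_mul_sq_norm_add_inner hb, ← hN,
        Real.exp_add, show ‖w k‖ ^ 2 / (4 * b) = (τ * ‖w k‖ ^ 2 / M) / 2 by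
          rw [hbdef]; field_simp; ring]
      ring
    simp_rw [h1]
    rw [← Finset.sum_mul, ← Finset.mul_sum]
    refine mul_le_mul_of_nonneg_right ?_ hNpos.le
    have hwB : ∀ k, ‖w k‖ ^ 2 ≤ B ^ 2 := fun k => by gcongr; exact hB k
    have h2 : ∀ k, Real.exp (inner ℝ h (w k) + (τ * ‖w k‖ ^ 2 / M) / 2) - 1 ≤
        inner ℝ h (w k) + (τ / (2 * M)) * ‖w k‖ ^ 2 +
          (2 * inner ℝ h (w k) ^ 2 + (τ ^ 2 * B ^ 2 / (2 * M ^ 2)) * ‖w k‖ ^ 2) := fun k => by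
      refine (exp_sub_one_le_of_abs_le ?_ (by positivity) ?_).trans ?_
      · refine (abs_real_inner_le_norm _ _).trans (le_trans ?_ hτB)
        exact mul_le_mul hh (hB k) (norm_nonneg _) hτ.le
      · rw [div_le_one hM0]
        exact (mul_le_mul_of_nonneg_left (hwB k) hτ.le).trans hτM
      · have : (τ * ‖w k‖ ^ 2 / M) ^ 2 / 2 ≤ (τ ^ 2 * B ^ 2 / (2 * M ^ 2)) * ‖w k‖ ^ 2 := by
          have := mul_le_mul_of_nonneg_left (hwB k)
            (show 0 ≤ τ ^ 2 * ‖w k‖ ^ 2 / (2 * M ^ 2) by positivity)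
          calc _ = τ ^ 2 * ‖w k‖ ^ 2 / (2 * M ^ 2) * ‖w k‖ ^ 2 := by field_simp
            _ ≤ _ := this
            _ = _ := by ring
        have e : (τ * ‖w k‖ ^ 2 / M) / 2 = (τ / (2 * M)) * ‖w k‖ ^ 2 := by field_simp
        linarith
    calc p * ∑ k, (Real.exp (inner ℝ h (w k) + (τ * ‖w k‖ ^ 2 / M) / 2) - 1)
        ≤ p * ∑ k, (inner ℝ h (w k) + (τ / (2 * M)) * ‖w k‖ ^ 2 +
          (2 * inner ℝ h (w k) ^ 2 + (τ ^ 2 * B ^ 2 / (2 * M ^ 2)) * ‖w k‖ ^ 2)) := by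
          gcongr with k _
          exact h2 k
      _ = (τ / (2 * M) + τ ^ 2 * B ^ 2 / (2 * M ^ 2)) * (p * ∑ k, ‖w k‖ ^ 2) +
          2 * (p * ∑ k, inner ℝ h (w k) ^ 2) := by
          simp only [Finset.sum_add_distrib, ← Finset.mul_sum]
          rw [← inner_sum, hw0, inner_zero_right]
          ring
      _ ≤ (τ / (2 * M) + τ ^ 2 * B ^ 2 / (2 * M ^ 2)) * M ^ 2 + 2 * (S * τ ^ 2) := by
          have := (hS h).trans (mul_le_mul_of_nonneg_left
            (pow_le_pow_left₀ (norm_nonneg h) hh 2) hS0)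
          gcongr
      _ = R := by rw [hRdef]; field_simp; ring
  set v : (κ → Bool) → E := fun ω => ∑ k, (if ω k then (1 : ℝ) else 0) • w k with hv
  set W : (κ → Bool) → ℝ := fun ω => ∏ k, if ω k then p else 1 - p with hW
  have hW0 : ∀ ω, 0 ≤ W ω := fun ω => Finset.prod_nonneg fun k _ => by
    split_ifs <;> linarith
  have hint : ∀ ω ∈ Finset.univ, MeasureTheory.Integrable
      fun x => W ω * (Real.exp (inner ℝ x (v ω) - L x) * Real.exp (-b * ‖x‖ ^ 2)) :=
    fun ω _ => by
    refine MeasureTheory.Integrable.const_mul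
      ((integrable_exp_neg_mul_sq_norm_add_inner hb (v ω)).mono' (by fun_prop)
      (Filter.Eventually.of_forall fun x => ?_)) _
    rw [norm_mul, Real.norm_eq_abs, Real.norm_eq_abs, Real.abs_exp, Real.abs_exp, ← Real.exp_add,
      real_inner_comm]
    exact Real.exp_le_exp.2 (by linarith [hL0 x])
  have hpoint : ∀ ω, Real.exp (τ * ‖v ω‖) * Real.exp (-(τ * M / 2) - R) * N ≤
      ∫ x, Real.exp (inner ℝ x (v ω) - L x) * Real.exp (-b * ‖x‖ ^ 2) := fun ω => by
    set h := (τ * ‖v ω‖⁻¹) • v ω with hh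
    have hle : ‖h‖ ≤ τ := by
      rw [hh, norm_smul, Real.norm_eq_abs, abs_of_nonneg (by positivity), mul_assoc]
      exact mul_le_of_le_one_right hτ.le (inv_mul_le_one (a := ‖v ω‖))
    refine le_trans ?_ (exp_mul_integral_le_integral_exp_sub hb (v ω) h hLc hL0 ?_ (hR h hle))
    · rw [← Real.exp_add]
      gcongr
      have e1 : inner ℝ h (v ω) = τ * ‖v ω‖ := by
        rw [hh, inner_smul_left, real_inner_self_eq_norm_sq]
        rcases eq_or_ne ‖v ω‖ 0 with h0 | h0
        · simp [h0]
        · simp only [conj_trivial]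
          field_simp
      have e2 : b * ‖h‖ ^ 2 ≤ τ * M / 2 := by
        calc b * ‖h‖ ^ 2 ≤ b * τ ^ 2 := by gcongr
          _ = _ := by rw [hbdef]; field_simp
      linarith
    · simp_rw [hterm h]
      exact MeasureTheory.integrable_finsetSum _ (htermi h)
  have hmain : (∑ ω, W ω * Real.exp (τ * ‖v ω‖)) * Real.exp (-(τ * M / 2) - R) * N ≤ 1 * N := by
    calc (∑ ω, W ω * Real.exp (τ * ‖v ω‖)) * Real.exp (-(τ * M / 2) - R) * N
        = ∑ ω, W ω * (Real.exp (τ * ‖v ω‖) * Real.exp (-(τ * M / 2) - R) * N) := by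
          rw [Finset.sum_mul, Finset.sum_mul]
          exact Finset.sum_congr rfl fun ω _ => by ring
      _ ≤ ∑ ω, W ω * ∫ x, Real.exp (inner ℝ x (v ω) - L x) * Real.exp (-b * ‖x‖ ^ 2) :=
          Finset.sum_le_sum fun ω _ => mul_le_mul_of_nonneg_left (hpoint ω) (hW0 ω)
      _ = ∫ x, ∑ ω, W ω * (Real.exp (inner ℝ x (v ω) - L x) * Real.exp (-b * ‖x‖ ^ 2)) := by
          rw [MeasureTheory.integral_finsetSum _ hint]
          simp_rw [MeasureTheory.integral_const_mul]
      _ ≤ N := by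
          refine MeasureTheory.integral_mono (MeasureTheory.integrable_finsetSum _ hint) hg
            fun x => ?_
          have hx : ∑ ω, W ω * Real.exp (inner ℝ x (v ω)) ≤ Real.exp (L x) := by
            refine le_trans (le_of_eq ?_)
              (sum_bernoulli_mul_exp_le hp0 hp1 fun k => inner ℝ x (w k))
            refine Finset.sum_congr rfl fun ω _ => ?_
            simp only [hv, hW, inner_sum, inner_smul_right, ite_mul, one_mul, zero_mul]
          calc ∑ ω, W ω * (Real.exp (inner ℝ x (v ω) - L x) * Real.exp (-b * ‖x‖ ^ 2))
              = (∑ ω, W ω * Real.exp (inner ℝ x (v ω))) * Real.exp (-L x) *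
                  Real.exp (-b * ‖x‖ ^ 2) := by
                rw [Finset.sum_mul, Finset.sum_mul]
                refine Finset.sum_congr rfl fun ω _ => ?_
                rw [sub_eq_add_neg, Real.exp_add]
                ring
            _ ≤ Real.exp (L x) * Real.exp (-L x) * Real.exp (-b * ‖x‖ ^ 2) := by gcongr
            _ = Real.exp (-b * ‖x‖ ^ 2) := by rw [← Real.exp_add]; simp
      _ = 1 * N := (one_mul N).symm
  have hfin := le_of_mul_le_mul_right hmain hNpos
  calc ∑ ω, W ω * Real.exp (τ * ‖v ω‖)
      = (∑ ω, W ω * Real.exp (τ * ‖v ω‖)) * Real.exp (-(τ * M / 2) - R) *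
          Real.exp (τ * M / 2 + R) := by
        rw [mul_assoc, ← Real.exp_add]
        simp
    _ ≤ 1 * Real.exp (τ * M / 2 + R) := by gcongr
    _ = _ := by
        rw [one_mul, hRdef]
        congr 1
        ring

end GaussianIntegrals

lemma sum_signs_mul_exp_le {ι : Type*} [Fintype ι] [DecidableEq ι] (y : ι → ℝ) :
    ∑ z : ι → Bool, ((1 : ℝ) / 2) ^ Fintype.card ι *
        Real.exp (∑ t, y t * (if z t then (1 : ℝ) else -1)) ≤
      Real.exp (∑ t, y t ^ 2 / 2) := by
  have h : ∀ z : ι → Bool, ((1 : ℝ) / 2) ^ Fintype.card ι *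
      Real.exp (∑ t, y t * (if z t then (1 : ℝ) else -1)) =
      ∏ t, (1 / 2 * Real.exp (y t * (if z t then (1 : ℝ) else -1))) := fun z => by
    rw [Real.exp_sum, Finset.prod_mul_distrib, Finset.prod_const, Finset.card_univ]
  simp_rw [h]
  rw [← Fintype.prod_sum
    (fun t (c : Bool) => 1 / 2 * Real.exp (y t * (if c then (1 : ℝ) else -1))), Real.exp_sum]
  refine Finset.prod_le_prod (fun t _ => by positivity) fun t _ => ?_
  refine le_trans (le_of_eq ?_) (Real.cosh_le_exp_half_sq (y t))
  simp only [Fintype.sum_bool, if_true, Bool.false_eq_true, if_false, Real.cosh_eq]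
  ring_nf

lemma sum_signs_eq_one (ι : Type*) [Fintype ι] [DecidableEq ι] :
    ∑ _z : ι → Bool, ((1 : ℝ) / 2) ^ Fintype.card ι = 1 := by
  simp [Finset.sum_const, Finset.card_univ]

/-- Hoeffding's inequality for random signs. -/
lemma sum_signs_one_lt_abs_le {ι : Type*} [Fintype ι] [DecidableEq ι] {l : ℝ} (hl : 0 < l)
    (c : ι → ℝ) (hc : ∑ t, c t ^ 2 ≤ l ^ 2) :
    ∑ z : ι → Bool, (if 1 < |∑ t, c t * (if z t then (1 : ℝ) else -1)| then
        ((1 : ℝ) / 2) ^ Fintype.card ι else 0) ≤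
      2 * Real.exp (-(1 / (2 * l ^ 2))) := by
  set θ := 1 / l ^ 2 with hθ
  have hθ0 : 0 < θ := by positivity
  have hmgf : ∀ e : ℝ, e ^ 2 = 1 → ∑ z : ι → Bool, ((1 : ℝ) / 2) ^ Fintype.card ι *
      Real.exp (∑ t, (e * θ * c t) * (if z t then (1 : ℝ) else -1)) ≤
      Real.exp (1 / (2 * l ^ 2)) := fun e he => by
    refine (sum_signs_mul_exp_le _).trans (Real.exp_le_exp.2 ?_)
    calc ∑ t, (e * θ * c t) ^ 2 / 2 = θ ^ 2 / 2 * ∑ t, c t ^ 2 := by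
          rw [Finset.mul_sum]
          exact Finset.sum_congr rfl fun t _ => by rw [mul_pow, mul_pow, he]; ring
      _ ≤ θ ^ 2 / 2 * l ^ 2 := by gcongr
      _ = 1 / (2 * l ^ 2) := by rw [hθ]; field_simp
  have hpt : ∀ z : ι → Bool, (if 1 < |∑ t, c t * (if z t then (1 : ℝ) else -1)| then
        ((1 : ℝ) / 2) ^ Fintype.card ι else 0) ≤ Real.exp (-θ) *
      (((1 : ℝ) / 2) ^ Fintype.card ι *
          Real.exp (∑ t, (1 * θ * c t) * (if z t then (1 : ℝ) else -1)) +
        ((1 : ℝ) / 2) ^ Fintype.card ι *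
          Real.exp (∑ t, (-1 * θ * c t) * (if z t then (1 : ℝ) else -1))) := fun z => by
    have e1 : ∀ e : ℝ, ∑ t, (e * θ * c t) * (if z t then (1 : ℝ) else -1) =
        e * θ * ∑ t, c t * (if z t then (1 : ℝ) else -1) := fun e => by
      rw [Finset.mul_sum]
      exact Finset.sum_congr rfl fun t _ => by ring
    simp only [e1]
    set X := ∑ t, c t * (if z t then (1 : ℝ) else -1)
    split_ifs with hX
    · rw [← mul_add, mul_left_comm]
      refine le_mul_of_one_le_right (by positivity) ?_
      rw [mul_add, ← Real.exp_add, ← Real.exp_add]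
      rcases lt_abs.1 hX with h | h
      · have : 1 ≤ Real.exp (-θ + 1 * θ * X) := Real.one_le_exp (by nlinarith)
        linarith [Real.exp_pos (-θ + -1 * θ * X)]
      · have : 1 ≤ Real.exp (-θ + -1 * θ * X) := Real.one_le_exp (by nlinarith)
        linarith [Real.exp_pos (-θ + 1 * θ * X)]
    · positivity
  refine (Finset.sum_le_sum fun z _ => hpt z).trans ?_
  rw [← Finset.mul_sum, Finset.sum_add_distrib]
  calc Real.exp (-θ) * _ ≤ Real.exp (-θ) *
        (Real.exp (1 / (2 * l ^ 2)) + Real.exp (1 / (2 * l ^ 2))) := by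
        gcongr
        · exact hmgf 1 (by norm_num)
        · exact hmgf (-1) (by norm_num)
    _ = 2 * (Real.exp (-θ) * Real.exp (1 / (2 * l ^ 2))) := by ring
    _ = _ := by
        rw [← Real.exp_add, hθ]
        congr 2
        field_simp
        ring

lemma sq_mul_sum_sq_inv_mulVec_le {ι : Type*} [Fintype ι] [DecidableEq ι] {κ : ℝ} (hκ : 0 < κ)
    (A : Matrix ι ι ℝ) (hA : ∀ f : ι → ℝ, κ * ∑ t, f t ^ 2 ≤ f ⬝ᵥ A.mulVec f) (v : ι → ℝ) :
    κ ^ 2 * ∑ t, (A⁻¹.mulVec v) t ^ 2 ≤ ∑ t, v t ^ 2 := by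
  have hinj : Function.Injective A.mulVec := by
    refine (injective_iff_map_eq_zero A.mulVecLin).2 fun f hf => ?_
    have h := hA f
    rw [← Matrix.mulVecLin_apply, hf, dotProduct_zero] at h
    have h0 : ∑ t, f t ^ 2 = 0 :=
      le_antisymm (by nlinarith) (Finset.sum_nonneg fun t _ => sq_nonneg _)
    funext t
    exact pow_eq_zero_iff (two_ne_zero) |>.1
      ((Finset.sum_eq_zero_iff_of_nonneg fun t _ => sq_nonneg _).1 h0 t (Finset.mem_univ t))
  have hdet : IsUnit A.det :=
    (Matrix.isUnit_iff_isUnit_det A).1 (Matrix.mulVec_injective_iff_isUnit.1 hinj)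
  set c := A⁻¹.mulVec v with hc
  have hAc : A.mulVec c = v := by
    rw [hc, Matrix.mulVec_mulVec, Matrix.mul_nonsing_inv _ hdet, Matrix.one_mulVec]
  have h1 := hA c
  rw [hAc] at h1
  have h2 : (c ⬝ᵥ v) ^ 2 ≤ (∑ t, c t ^ 2) * ∑ t, v t ^ 2 :=
    Finset.sum_mul_sq_le_sq_mul_sq _ _ _
  have hs : 0 ≤ ∑ t, c t ^ 2 := Finset.sum_nonneg fun t _ => sq_nonneg _
  have h3 : (κ * ∑ t, c t ^ 2) ^ 2 ≤ (c ⬝ᵥ v) ^ 2 := pow_le_pow_left₀ (by positivity) h1 2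
  rcases hs.eq_or_lt with h0 | h0
  · rw [← h0, mul_zero]
    exact Finset.sum_nonneg fun t _ => sq_nonneg _
  · refine le_of_mul_le_mul_left ?_ h0
    calc (∑ t, c t ^ 2) * (κ ^ 2 * ∑ t, c t ^ 2) = (κ * ∑ t, c t ^ 2) ^ 2 := by ring
      _ ≤ _ := h3.trans h2

lemma bweight_nonneg {n m : ℕ} (hmn : m ≤ n) (ω : Fin n → Bool) : 0 ≤ bweight n m ω := by
  have h : (m : ℝ) / n ≤ 1 := div_le_one_of_le₀ (by exact_mod_cast hmn) (by positivity)
  refine Finset.prod_nonneg fun k _ => ?_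
  split_ifs
  · positivity
  · linarith

lemma sum_bweight (n m : ℕ) : ∑ ω : Fin n → Bool, bweight n m ω = 1 := by
  unfold bweight
  rw [← Fintype.prod_sum
    (fun (_ : Fin n) (c : Bool) => if c then (m : ℝ) / n else 1 - (m : ℝ) / n)]
  simp

lemma jprob_eq {n m : ℕ} {T : Finset (Fin n)} (E : (Fin n → Bool) × (↥T → Bool) → Prop) :
    jprob n m E = ∑ ω : Fin n → Bool, bweight n m ω *
      ∑ z : ↥T → Bool, if E (ω, z) then ((1 : ℝ) / 2) ^ Fintype.card ↥T else 0 := by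
  unfold jprob
  rw [Fintype.sum_prod_type]
  refine Finset.sum_congr rfl fun ω _ => ?_
  rw [Finset.mul_sum]
  refine Finset.sum_congr rfl fun z _ => ?_
  rw [Fintype.card_coe, mul_ite, mul_zero]

lemma sum_signs_ite_le_one {ι : Type*} [Fintype ι] [DecidableEq ι] (P : (ι → Bool) → Prop) :
    ∑ z : ι → Bool, (if P z then ((1 : ℝ) / 2) ^ Fintype.card ι else 0) ≤ 1 := by
  refine le_trans (Finset.sum_le_sum fun z _ => ?_) (sum_signs_eq_one ι).le
  split_ifs
  · exact le_rfl
  · positivity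

lemma jprob_nonneg {n m : ℕ} (hmn : m ≤ n) {T : Finset (Fin n)}
    (E : (Fin n → Bool) × (↥T → Bool) → Prop) : 0 ≤ jprob n m E := by
  refine Finset.sum_nonneg fun p _ => ?_
  have := bweight_nonneg hmn p.1
  split_ifs <;> positivity

lemma jprob_le_one {n m : ℕ} (hmn : m ≤ n) {T : Finset (Fin n)}
    (E : (Fin n → Bool) × (↥T → Bool) → Prop) : jprob n m E ≤ 1 := by
  rw [jprob_eq]
  refine le_trans ?_ (sum_bweight n m).le
  exact Finset.sum_le_sum fun ω _ =>
    mul_le_of_le_one_right (bweight_nonneg hmn ω) (sum_signs_ite_le_one _)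

/-- Union bound: off `bad`, each event `X t₀` is controlled either conditionally on the sampling
or by the exceptional sampling event `G t₀`. -/
lemma jprob_or_exists_le {n m : ℕ} (hmn : m ≤ n) {T : Finset (Fin n)}
    (bad : (Fin n → Bool) → Prop) (X : Fin n → (Fin n → Bool) × (↥T → Bool) → Prop)
    (G : Fin n → (Fin n → Bool) → Prop) {α β : ℝ} (hα : 0 ≤ α) (hβ : 0 ≤ β)
    (hX : ∀ t₀, t₀ ∉ T → ∀ ω, ¬ bad ω → ¬ G t₀ ω →
      ∑ z : ↥T → Bool, (if X t₀ (ω, z) then ((1 : ℝ) / 2) ^ Fintype.card ↥T else 0) ≤ α)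
    (hG : ∀ t₀, t₀ ∉ T → bprob n m (G t₀) ≤ β) :
    jprob n m (T := T) (fun q => bad q.1 ∨ ∃ t₀, t₀ ∉ T ∧ X t₀ q) ≤
      n * α + n * β + jprob n m (T := T) (fun q => bad q.1) := by
  obtain ⟨E, hE⟩ : ∃ E : (Fin n → Bool) × (↥T → Bool) → Prop,
      E = fun q => bad q.1 ∨ ∃ t₀, t₀ ∉ T ∧ X t₀ q := ⟨_, rfl⟩
  rw [← hE]
  have hpt : ∀ ω, ∑ z : ↥T → Bool, (if E (ω, z) then
      ((1 : ℝ) / 2) ^ Fintype.card ↥T else 0) ≤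
      (∑ t₀ ∈ Tᶜ, (α + if G t₀ ω then 1 else 0)) +
        ∑ z : ↥T → Bool, if bad ω then ((1 : ℝ) / 2) ^ Fintype.card ↥T else 0 := fun ω => by
    by_cases hb : bad ω
    · simp only [hE, hb, true_or, if_true]
      refine le_add_of_nonneg_left (Finset.sum_nonneg fun t₀ _ => ?_)
      split_ifs <;> linarith
    · simp only [hE, hb, false_or, if_false, Finset.sum_const_zero, add_zero]
      calc ∑ z : ↥T → Bool, (if ∃ t₀, t₀ ∉ T ∧ X t₀ (ω, z) then
            ((1 : ℝ) / 2) ^ Fintype.card ↥T else 0)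
          ≤ ∑ z : ↥T → Bool, ∑ t₀ ∈ Tᶜ, (if X t₀ (ω, z) then
            ((1 : ℝ) / 2) ^ Fintype.card ↥T else 0) := by
            refine Finset.sum_le_sum fun z _ => ?_
            have hnn : ∀ t₀ ∈ Tᶜ, 0 ≤ (if X t₀ (ω, z) then
              ((1 : ℝ) / 2) ^ Fintype.card ↥T else 0) := fun t₀ _ => by
              split_ifs <;> positivity
            split_ifs with h
            · obtain ⟨t₀, ht, hx⟩ := h
              refine le_trans (le_of_eq ?_)
                (Finset.single_le_sum hnn (Finset.mem_compl.2 ht))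
              rw [if_pos hx]
            · exact Finset.sum_nonneg hnn
        _ = ∑ t₀ ∈ Tᶜ, ∑ z : ↥T → Bool, (if X t₀ (ω, z) then
            ((1 : ℝ) / 2) ^ Fintype.card ↥T else 0) := Finset.sum_comm
        _ ≤ _ := by
            refine Finset.sum_le_sum fun t₀ ht => ?_
            split_ifs with hg
            · linarith [sum_signs_ite_le_one fun z => X t₀ (ω, z)]
            · simpa using hX t₀ (Finset.mem_compl.1 ht) ω hb hg
  have hcard : ((Tᶜ.card : ℕ) : ℝ) ≤ n := by
    exact_mod_cast (Finset.card_le_univ Tᶜ).trans_eq (Fintype.card_fin n)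
  rw [jprob_eq, jprob_eq]
  refine (Finset.sum_le_sum fun ω _ =>
    mul_le_mul_of_nonneg_left (hpt ω) (bweight_nonneg hmn ω)).trans ?_
  simp only [mul_add, Finset.sum_add_distrib]
  gcongr
  · rw [← Finset.sum_mul, sum_bweight, one_mul, Finset.sum_const, nsmul_eq_mul]
    gcongr
  · simp_rw [Finset.mul_sum]
    rw [Finset.sum_comm]
    calc ∑ t₀ ∈ Tᶜ, ∑ ω, bweight n m ω * (if G t₀ ω then 1 else 0)
        ≤ ∑ _t₀ ∈ Tᶜ, β := Finset.sum_le_sum fun t₀ ht => by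
          refine le_trans (le_of_eq ?_) (hG t₀ (Finset.mem_compl.1 ht))
          exact Finset.sum_congr rfl fun ω _ => by simp
      _ ≤ n * β := by
          rw [Finset.sum_const, nsmul_eq_mul]
          gcongr

lemma abs_le_coh {n : ℕ} (U : Matrix (Fin n) (Fin n) ℝ) (k j : Fin n) : |U k j| ≤ coh U :=
  (le_ciSup (f := fun j => |U k j|) (Set.finite_range _).bddAbove j).trans
    (le_ciSup (f := fun k => ⨆ j, |U k j|) (Set.finite_range _).bddAbove k)

lemma sq_le_coh_sq {n : ℕ} (U : Matrix (Fin n) (Fin n) ℝ) (k j : Fin n) :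
    U k j ^ 2 ≤ coh U ^ 2 := by
  rw [← sq_abs]
  exact pow_le_pow_left₀ (abs_nonneg _) (abs_le_coh U k j) 2

lemma sum_mul_col {n : ℕ} {U : Matrix (Fin n) (Fin n) ℝ}
    (hU : Uᵀ * U = (n : ℝ) • (1 : Matrix (Fin n) (Fin n) ℝ)) (i j : Fin n) :
    ∑ k, U k i * U k j = if i = j then (n : ℝ) else 0 := by
  have h := congrFun (congrFun hU i) j
  simpa [Matrix.mul_apply, Matrix.one_apply] using h

lemma coh_pos {n : ℕ} {U : Matrix (Fin n) (Fin n) ℝ} (hn : 0 < n)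
    (hU : Uᵀ * U = (n : ℝ) • (1 : Matrix (Fin n) (Fin n) ℝ)) : 0 < coh U := by
  by_contra! h
  have h0 : ∀ k j, U k j = 0 := fun k j =>
    abs_nonpos_iff.1 ((abs_le_coh U k j).trans h)
  have := sum_mul_col hU ⟨0, hn⟩ ⟨0, hn⟩
  simp only [h0, mul_zero, Finset.sum_const_zero, if_true] at this
  exact hn.ne (by exact_mod_cast this)

lemma sum_sq_sum_mul_row {n : ℕ} {U : Matrix (Fin n) (Fin n) ℝ}
    (hU : Uᵀ * U = (n : ℝ) • (1 : Matrix (Fin n) (Fin n) ℝ)) (T : Finset (Fin n))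
    (f : ↥T → ℝ) : ∑ k, (∑ t, f t * U k t) ^ 2 = n * ∑ t, f t ^ 2 := by
  calc ∑ k, (∑ t, f t * U k t) ^ 2
      = ∑ k, ∑ s, ∑ t, f s * f t * (U k s * U k t) := by
        refine Finset.sum_congr rfl fun k _ => ?_
        rw [sq, Finset.sum_mul_sum]
        exact Finset.sum_congr rfl fun s _ => Finset.sum_congr rfl fun t _ => by ring
    _ = ∑ s, ∑ t, f s * f t * ∑ k, U k s * U k t := by
        rw [Finset.sum_comm]
        refine Finset.sum_congr rfl fun s _ => ?_
        rw [Finset.sum_comm]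
        exact Finset.sum_congr rfl fun t _ => (Finset.mul_sum _ _ _).symm
    _ = n * ∑ t, f t ^ 2 := by
        rw [Finset.mul_sum]
        refine Finset.sum_congr rfl fun s _ => ?_
        simp only [sum_mul_col hU, Subtype.coe_inj, mul_ite, mul_zero, Finset.sum_ite_eq,
          Finset.mem_univ, if_true]
        ring

/-- Deviation inequality for `‖v^{t₀}‖`, with the deviation scale `s` abstracted. -/
lemma bprob_lt_norm_le {n m : ℕ} {U : Matrix (Fin n) (Fin n) ℝ}
    (hU : Uᵀ * U = (n : ℝ) • (1 : Matrix (Fin n) (Fin n) ℝ)) {T : Finset (Fin n)}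
    (hT : T.Nonempty) (hm : 0 < m) (hmn : m ≤ n) (hμm : coh U ^ 2 ≤ m) {a s : ℝ} (ha : 0 < a)
    (hs : 0 < s) (hs1 : coh U ^ 2 * m ≤ s ^ 2) (hs2 : coh U ^ 4 * T.card ≤ s ^ 2)
    (has : a ^ 2 * (coh U ^ 4 * T.card) ≤ s ^ 2) {t₀ : Fin n} (ht₀ : t₀ ∉ T) :
    bprob n m (fun ω => coh U * √(T.card * m) + a * s <
      ‖∑ k, (if ω k then (1 : ℝ) else 0) •
        (WithLp.toLp 2 (fun t : ↥T => U k t₀ * U k t) : EuclideanSpace ℝ ↥T)‖) ≤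
      Real.exp (-(1 / 10 * a ^ 2)) := by
  have hn : 0 < n := hm.trans_le hmn
  have hnR : (0 : ℝ) < n := by exact_mod_cast hn
  have hmR : (0 : ℝ) < m := by exact_mod_cast hm
  have hcR : (0 : ℝ) < T.card := by exact_mod_cast hT.card_pos
  have hμ := coh_pos hn hU
  set μ := coh U with hμdef
  set w : Fin n → EuclideanSpace ℝ ↥T := fun k => WithLp.toLp 2 (fun t : ↥T => U k t₀ * U k t)
    with hw
  have hp1 : (m : ℝ) / n ≤ 1 := div_le_one_of_le₀ (by exact_mod_cast hmn) hnR.le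
  set M := μ * √(T.card * m) with hMdef
  have hM0 : 0 < M := by positivity
  have hM2 : M ^ 2 = μ ^ 2 * (T.card * m) := by
    rw [hMdef, mul_pow, Real.sq_sqrt (by positivity)]
  set B := μ ^ 2 * √(T.card) with hBdef
  have hB2 : B ^ 2 = μ ^ 4 * T.card := by
    rw [hBdef, mul_pow, Real.sq_sqrt (by positivity)]; ring
  have hB0 : 0 < B := by positivity
  have hBM : B ≤ M := by
    refine le_of_sq_le_sq ?_ hM0.le
    rw [hB2, hM2]
    calc μ ^ 4 * T.card = μ ^ 2 * (T.card * μ ^ 2) := by ring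
      _ ≤ _ := by gcongr
  have haB : a * B ≤ s := by
    refine le_of_sq_le_sq ?_ hs.le
    rw [mul_pow, hB2]
    exact has
  have hrow : ∀ k, ∑ t : ↥T, U k t ^ 2 ≤ μ ^ 2 * T.card := fun k => by
    calc ∑ t : ↥T, U k t ^ 2 ≤ ∑ _t : ↥T, μ ^ 2 :=
          Finset.sum_le_sum fun t _ => sq_le_coh_sq U k t
      _ = _ := by rw [Finset.sum_const, Finset.card_univ, Fintype.card_coe, nsmul_eq_mul]; ring
  have hwn : ∀ k, ‖w k‖ ^ 2 = U k t₀ ^ 2 * ∑ t : ↥T, U k t ^ 2 := fun k => by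
    rw [EuclideanSpace.real_norm_sq_eq, Finset.mul_sum]
    exact Finset.sum_congr rfl fun t _ => by simp only [hw]; ring
  have hrow0 : ∀ k, 0 ≤ ∑ t : ↥T, U k t ^ 2 := fun k => Finset.sum_nonneg fun t _ => sq_nonneg _
  have hw0 : ∑ k, w k = 0 := by
    ext t
    have hne : t₀ ≠ t := fun h => ht₀ (h ▸ t.2)
    simp [hw, sum_mul_col hU, hne]
  have hS : ∀ f : EuclideanSpace ℝ ↥T,
      (m : ℝ) / n * ∑ k, inner ℝ f (w k) ^ 2 ≤ (μ ^ 2 * m) * ‖f‖ ^ 2 := fun f => by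
    have h1 : ∀ k, inner ℝ f (w k) ^ 2 ≤ μ ^ 2 * (∑ t, f t * U k t) ^ 2 := fun k => by
      have : inner ℝ f (w k) = U k t₀ * ∑ t, f t * U k t := by
        rw [PiLp.inner_apply, Finset.mul_sum]
        refine Finset.sum_congr rfl fun t _ => ?_
        simp [hw]
        ring
      rw [this, mul_pow]
      exact mul_le_mul_of_nonneg_right (sq_le_coh_sq U k t₀) (sq_nonneg _)
    calc (m : ℝ) / n * ∑ k, inner ℝ f (w k) ^ 2
        ≤ (m : ℝ) / n * ∑ k, μ ^ 2 * (∑ t, f t * U k t) ^ 2 := by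
          gcongr with k _
          exact h1 k
      _ = _ := by
          rw [← Finset.mul_sum, sum_sq_sum_mul_row hU T, EuclideanSpace.real_norm_sq_eq]
          field_simp
  have hM : (m : ℝ) / n * ∑ k, ‖w k‖ ^ 2 ≤ M ^ 2 := by
    calc (m : ℝ) / n * ∑ k, ‖w k‖ ^ 2
        ≤ (m : ℝ) / n * ∑ k, U k t₀ * U k t₀ * (μ ^ 2 * T.card) := by
          gcongr with k _
          rw [hwn, sq (U k t₀)]
          exact mul_le_mul_of_nonneg_left (hrow k) (mul_self_nonneg _)
      _ = M ^ 2 := by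
          rw [← Finset.sum_mul, sum_mul_col hU, if_pos rfl, hM2]
          field_simp
  have hB : ∀ k, ‖w k‖ ≤ B := fun k => by
    refine le_of_sq_le_sq ?_ hB0.le
    rw [hwn, hB2]
    calc U k t₀ ^ 2 * ∑ t : ↥T, U k t ^ 2 ≤ μ ^ 2 * (μ ^ 2 * T.card) :=
          mul_le_mul (sq_le_coh_sq U k t₀) (hrow k) (hrow0 k) (sq_nonneg _)
      _ = _ := by ring
  set τ := a / (5 * s) with hτdef
  have hτ : 0 < τ := by positivity
  have hτB : τ * B ≤ 1 / 5 := by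
    rw [hτdef, div_mul_eq_mul_div, div_le_div_iff₀ (by positivity) (by norm_num)]
    linarith
  have hτM : τ * B ^ 2 ≤ M := by nlinarith
  have hmgf := sum_bernoulli_mul_exp_norm_le (by positivity) hp1 w hw0 hS (by positivity) hM hM0 hB
    hτ (by linarith) hτM
  set v : (Fin n → Bool) → EuclideanSpace ℝ ↥T :=
    fun ω => ∑ k, (if ω k then (1 : ℝ) else 0) • w k with hv
  have hpt : ∀ ω, (if M + a * s < ‖v ω‖ then bweight n m ω else 0) ≤
      bweight n m ω * Real.exp (τ * ‖v ω‖) * Real.exp (-(τ * (M + a * s))) := fun ω => by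
    have hW := bweight_nonneg hmn ω
    split_ifs with h
    · rw [mul_assoc, ← Real.exp_add]
      refine le_mul_of_one_le_right hW (Real.one_le_exp ?_)
      nlinarith
    · positivity
  have hsum : bprob n m (fun ω => M + a * s < ‖v ω‖) ≤
      (∑ ω, bweight n m ω * Real.exp (τ * ‖v ω‖)) * Real.exp (-(τ * (M + a * s))) := by
    rw [Finset.sum_mul]
    refine Finset.sum_le_sum fun ω _ => le_trans (le_of_eq ?_) (hpt ω)
    congr
  calc bprob n m (fun ω => M + a * s < ‖v ω‖)
      ≤ Real.exp (τ * M + τ ^ 2 * (2 * (μ ^ 2 * m) + B ^ 2 / 2)) *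
          Real.exp (-(τ * (M + a * s))) := hsum.trans (by gcongr; exact hmgf)
    _ ≤ Real.exp (-(1 / 10 * a ^ 2)) := by
        rw [← Real.exp_add]
        refine Real.exp_le_exp.2 ?_
        have h1 : τ ^ 2 * (2 * (μ ^ 2 * m) + B ^ 2 / 2) ≤ τ ^ 2 * (5 / 2 * s ^ 2) := by
          gcongr
          linarith
        have h2 : τ ^ 2 * (5 / 2 * s ^ 2) = 1 / 10 * a ^ 2 := by
          rw [hτdef]; field_simp; norm_num
        have h3 : τ * (a * s) = 1 / 5 * a ^ 2 := by
          rw [hτdef]; field_simp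
        linarith

/-- The variance proxy `σ̄²` dominates the squared length bound, also after scaling by `a²`. -/
lemma deviation_scale_bounds {μ c m a : ℝ} (hμ : 0 < μ) (hc : 0 < c) (hm : 0 < m) (ha : 0 < a)
    (hμm : μ ^ 2 ≤ m)
    (hcond : if 1 < μ * c / √m then a ≤ (m / μ ^ 2) ^ ((1 : ℝ) / 4)
      else a ≤ (m / (μ ^ 2 * c)) ^ ((1 : ℝ) / 2)) :
    μ ^ 2 * m ≤ μ ^ 2 * m * max 1 (μ * c / √m) ∧
      μ ^ 4 * c ≤ μ ^ 2 * m * max 1 (μ * c / √m) ∧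
      a ^ 2 * (μ ^ 4 * c) ≤ μ ^ 2 * m * max 1 (μ * c / √m) := by
  have hr : 0 < √m := Real.sqrt_pos.2 hm
  have hr2 : √m ^ 2 = m := Real.sq_sqrt hm.le
  have hμr : μ ≤ √m := Real.le_sqrt_of_sq_le hμm
  have hlin : μ ^ 2 * m * (μ * c / √m) = μ ^ 3 * c * √m := by
    rw [← hr2, Real.sqrt_sq hr.le]
    field_simp
  have h1 : μ ^ 2 * m ≤ μ ^ 2 * m * max 1 (μ * c / √m) :=
    le_mul_of_one_le_right (by positivity) (le_max_left _ _)
  have h2 : μ ^ 3 * c * √m ≤ μ ^ 2 * m * max 1 (μ * c / √m) := by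
    rw [← hlin]
    gcongr
    exact le_max_right _ _
  refine ⟨h1, le_trans ?_ h2, ?_⟩
  · calc μ ^ 4 * c = μ ^ 3 * c * μ := by ring
      _ ≤ _ := by gcongr
  · split_ifs at hcond
    · refine le_trans ?_ h2
      have h4 : a ^ 4 ≤ m / μ ^ 2 := by
        calc a ^ 4 ≤ ((m / μ ^ 2) ^ ((1 : ℝ) / 4)) ^ 4 := by gcongr
          _ = m / μ ^ 2 := by
            rw [← Real.rpow_natCast, ← Real.rpow_mul (by positivity)]
            norm_num
      have h5 : a ^ 2 ≤ √m / μ := by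
        refine le_of_sq_le_sq ?_ (by positivity)
        rw [div_pow, hr2]
        linarith
      calc a ^ 2 * (μ ^ 4 * c) ≤ √m / μ * (μ ^ 4 * c) := by gcongr
        _ = μ ^ 3 * c * √m := by field_simp
    · refine le_trans ?_ h1
      have h4 : a ^ 2 ≤ m / (μ ^ 2 * c) := by
        calc a ^ 2 ≤ ((m / (μ ^ 2 * c)) ^ ((1 : ℝ) / 2)) ^ 2 := by gcongr
          _ = m / (μ ^ 2 * c) := by
            rw [← Real.rpow_natCast, ← Real.rpow_mul (by positivity)]
            norm_num
      calc a ^ 2 * (μ ^ 4 * c) ≤ m / (μ ^ 2 * c) * (μ ^ 4 * c) := by gcongr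
        _ = μ ^ 2 * m := by field_simp

/-- final probability estimate in the proof of Theorem 1.1.
There is an absolute constant `γ > 0` such that, with coherence `μ`,
Bernoulli(m/n) sampling `Ω`, independent uniform signs `z` on `T`,
`v^{t₀} = Σ_k δ_k U_{k,t₀} u^k`, `π(t₀) = ⟨(U_{ΩT}ᵀU_{ΩT})⁻¹ v^{t₀}, z⟩`,
`σ̄² = μ²m·max(1, μ|T|/√m)`, `a > 0` as in Lemma 3.4, and
`λ = 2μ√(|T|/m) + 2aσ̄/m`:
`P(λ_min < m/2 or sup_{t₀∉T}|π(t₀)| > 1)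
  ≤ 2n·e^{-1/(2λ²)} + n·e^{-γa²} + P(λ_min < m/2)`. -/
theorem statement12 :
    ∃ γ : ℝ, 0 < γ ∧
      ∀ (n m : ℕ) (U : Matrix (Fin n) (Fin n) ℝ),
        Uᵀ * U = (n : ℝ) • (1 : Matrix (Fin n) (Fin n) ℝ) →
        ∀ T : Finset (Fin n),
          0 < m → m ≤ n →
          ∀ a : ℝ, 0 < a →
            (if 1 < coh U * T.card / Real.sqrt m then
                a ≤ ((m : ℝ) / coh U ^ 2) ^ ((1 : ℝ) / 4)
              else a ≤ ((m : ℝ) / (coh U ^ 2 * T.card)) ^ ((1 : ℝ) / 2)) →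
            jprob n m (T := T)
                (fun q =>
                  (∃ f : ↥T → ℝ,
                    f ⬝ᵥ (∑ k : Fin n,
                        (if q.1 k then (1 : ℝ) else 0) •
                          Matrix.vecMulVec (fun t : ↥T => U k t.1)
                            (fun t : ↥T => U k t.1)).mulVec f <
                      (m : ℝ) / 2 * ∑ t, f t ^ 2) ∨
                  (∃ t₀ : Fin n, t₀ ∉ T ∧
                    1 <
                      |∑ t : ↥T,
                        ((∑ k : Fin n,
                            (if q.1 k then (1 : ℝ) else 0) •
                              Matrix.vecMulVec (fun t : ↥T => U k t.1)
                                (fun t : ↥T => U k t.1))⁻¹.mulVec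
                          (fun t : ↥T =>
                            ∑ k : Fin n,
                              (if q.1 k then (1 : ℝ) else 0) * U k t₀ * U k t.1)) t *
                          (if q.2 t then (1 : ℝ) else -1)|)) ≤
              2 * n *
                  Real.exp
                    (-(1 /
                        (2 *
                          (2 * coh U * Real.sqrt ((T.card : ℝ) / m) +
                              2 * a * Real.sqrt (coh U ^ 2 * m *
                                max 1 (coh U * T.card / Real.sqrt m)) / m) ^ 2))) +
                (n : ℝ) * Real.exp (-(γ * a ^ 2)) +
                jprob n m (T := T)
                  (fun q =>
                    ∃ f : ↥T → ℝ,
                      f ⬝ᵥ (∑ k : Fin n,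
                          (if q.1 k then (1 : ℝ) else 0) •
                            Matrix.vecMulVec (fun t : ↥T => U k t.1)
                              (fun t : ↥T => U k t.1)).mulVec f <
                        (m : ℝ) / 2 * ∑ t, f t ^ 2) := by
  refine ⟨1 / 10, by norm_num, fun n m U hU T hm hmn a ha hcond => ?_⟩
  have hn : 0 < n := hm.trans_le hmn
  have hn1 : (1 : ℝ) ≤ n := by exact_mod_cast hn
  have hmR : (0 : ℝ) < m := by exact_mod_cast hm
  have hμ := coh_pos hn hU
  rcases T.eq_empty_or_nonempty with hTe | hT
  · exfalso
    subst hTe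
    norm_num at hcond
    linarith
  have hcR : (1 : ℝ) ≤ T.card := by exact_mod_cast hT.card_pos
  set s := √(coh U ^ 2 * m * max 1 (coh U * T.card / √m)) with hs
  set l := 2 * coh U * √((T.card : ℝ) / m) + 2 * a * s / m with hl
  have hs0 : 0 < s := Real.sqrt_pos.2 (by positivity)
  have hl0 : 0 < l := by positivity
  rcases lt_or_ge (m : ℝ) (coh U ^ 2) with hμm | hμm
  · have hl2 : 2 ≤ l := by
      have h1 : 1 ≤ coh U * √((T.card : ℝ) / m) := by
        refine le_of_sq_le_sq ?_ (by positivity)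
        rw [mul_pow, Real.sq_sqrt (by positivity), one_pow, ← mul_div_assoc, one_le_div hmR]
        nlinarith
      have h2 : 0 ≤ 2 * a * s / m := by positivity
      linarith
    have hexp : 1 / 2 ≤ Real.exp (-(1 / (2 * l ^ 2))) := by
      have h1 : 1 / (2 * l ^ 2) ≤ 1 / 2 := by
        apply one_div_le_one_div_of_le (by norm_num)
        nlinarith
      linarith [Real.add_one_le_exp (-(1 / (2 * l ^ 2)))]
    refine (jprob_le_one hmn _).trans ?_
    have h3 := jprob_nonneg hmn (T := T) (fun q =>
                    ∃ f : ↥T → ℝ,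
                      f ⬝ᵥ (∑ k : Fin n,
                          (if q.1 k then (1 : ℝ) else 0) •
                            Matrix.vecMulVec (fun t : ↥T => U k t.1)
                              (fun t : ↥T => U k t.1)).mulVec f <
                        (m : ℝ) / 2 * ∑ t, f t ^ 2)
    have h4 : 0 ≤ (n : ℝ) * Real.exp (-(1 / 10 * a ^ 2)) := by positivity
    nlinarith
  have hs2 : s ^ 2 = coh U ^ 2 * m * max 1 (coh U * T.card / √m) :=
    Real.sq_sqrt (by positivity)
  obtain ⟨hb1, hb2, hb3⟩ := deviation_scale_bounds hμ (by linarith) hmR ha hμm hcond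
  rw [← hs2] at hb1 hb2 hb3
  rw [mul_comm (2 : ℝ) (n : ℝ), mul_assoc]
  refine jprob_or_exists_le hmn
    (fun ω => ∃ f : ↥T → ℝ,
      f ⬝ᵥ (∑ k : Fin n, (if ω k then (1 : ℝ) else 0) •
        Matrix.vecMulVec (fun t : ↥T => U k t.1) (fun t : ↥T => U k t.1)).mulVec f <
      (m : ℝ) / 2 * ∑ t, f t ^ 2)
    (fun t₀ q => 1 < |∑ t : ↥T,
      ((∑ k : Fin n, (if q.1 k then (1 : ℝ) else 0) •
        Matrix.vecMulVec (fun t : ↥T => U k t.1) (fun t : ↥T => U k t.1))⁻¹.mulVec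
          (fun t : ↥T => ∑ k : Fin n, (if q.1 k then (1 : ℝ) else 0) * U k t₀ * U k t.1)) t *
        (if q.2 t then (1 : ℝ) else -1)|)
    (fun t₀ ω => coh U * √(T.card * m) + a * s <
      ‖∑ k, (if ω k then (1 : ℝ) else 0) •
        (WithLp.toLp 2 (fun t : ↥T => U k t₀ * U k t) : EuclideanSpace ℝ ↥T)‖)
    (α := 2 * Real.exp (-(1 / (2 * l ^ 2)))) (β := Real.exp (-(1 / 10 * a ^ 2)))
    (by positivity) (by positivity) (fun t₀ _ ω hgood hnorm => ?_)
    (fun t₀ ht₀ => bprob_lt_norm_le hU hT hm hmn hμm ha hs0 hb1 hb2 hb3 ht₀)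
  push Not at hgood hnorm
  set A := ∑ k : Fin n, (if ω k then (1 : ℝ) else 0) •
    Matrix.vecMulVec (fun t : ↥T => U k t.1) (fun t : ↥T => U k t.1) with hA
  set v : ↥T → ℝ := fun t => ∑ k : Fin n, (if ω k then (1 : ℝ) else 0) * U k t₀ * U k t.1 with hv
  have hinv := sq_mul_sum_sq_inv_mulVec_le (by positivity) A hgood v
  have hvn : ∑ t, v t ^ 2 = ‖∑ k, (if ω k then (1 : ℝ) else 0) •
      (WithLp.toLp 2 (fun t : ↥T => U k t₀ * U k t) : EuclideanSpace ℝ ↥T)‖ ^ 2 := by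
    rw [EuclideanSpace.real_norm_sq_eq]
    refine Finset.sum_congr rfl fun t _ => ?_
    simp only [hv, WithLp.ofLp_sum, Finset.sum_apply, WithLp.ofLp_smul, Pi.smul_apply, smul_eq_mul,
      mul_assoc]
  have hsum : ∑ t, (A⁻¹.mulVec v) t ^ 2 ≤ l ^ 2 := by
    have hsq : √((T.card : ℝ) * m) = √((T.card : ℝ) / m) * m := by
      rw [show (T.card : ℝ) * m = T.card / m * m ^ 2 by field_simp,
        Real.sqrt_mul (by positivity), Real.sqrt_sq hmR.le]
    have hle : coh U * √(T.card * m) + a * s = m / 2 * l := by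
      rw [hl, hsq]
      field_simp
    have h1 : ∑ t, v t ^ 2 ≤ (m / 2 * l) ^ 2 := by
      rw [hvn, ← hle]
      gcongr
    have h2 := hinv.trans h1
    rw [mul_pow] at h2
    exact le_of_mul_le_mul_left h2 (by positivity)
  refine le_trans (le_of_eq ?_) (sum_signs_one_lt_abs_le hl0 _ hsum)
  refine Finset.sum_congr rfl fun z _ => ?_
  congr
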